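/- arXiv:1905.01807 — 2 statements merged into one kernel-verified Lean document; each statement's English description precedes it below -/
import Mathlib

section
/- For λ₁ > 1, λ₂ > 0, and r ∈ [0,1), one has ∫₀^π sin^{λ₁-1}(t)/(1+r²-2r cos t)^{λ₂} dt = B(λ₁/2, 1/2) · F(λ₂, λ₂+(1-λ₁)/2; (1+λ₁)/2; r²), where B is the Beta function and F is the Gauss hypergeometric function. -/
open MeasureTheory Real

/-- The Gauss hypergeometric function `F(a,b;c;x)` as a power series sum. -/
noncomputable def hypF (a b c x : ℝ) : ℝ :=
  ∑' k : ℕ, (Polynomial.eval a (ascPochhammer ℝ k) * Polynomial.eval b (ascPochhammer ℝ k) /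
    (Polynomial.eval c (ascPochhammer ℝ k) * (k.factorial : ℝ))) * x ^ k

/-- The Beta function. -/
noncomputable def betaFn (a b : ℝ) : ℝ := Real.Gamma a * Real.Gamma b / Real.Gamma (a + b)

open Finset in
/-- Chu–Vandermonde in Pochhammer form. -/
theorem sum_choose_mul_ascPochhammer_div (k : ℕ) (a c : ℝ) (hc : 0 < c) :
    ∑ p ∈ antidiagonal k, (k.choose p.1 : ℝ) *
      ((-1) ^ p.1 * (ascPochhammer ℝ p.1).eval a / (ascPochhammer ℝ p.1).eval c) =
      (ascPochhammer ℝ k).eval (c - a) / (ascPochhammer ℝ k).eval c := by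
  induction k generalizing a c with
  | zero => simp
  | succ k ih =>
    have hsplit : ∀ n : ℕ, ∀ x : ℝ, (ascPochhammer ℝ (n + 1)).eval x =
        x * (ascPochhammer ℝ n).eval (x + 1) := fun n x => by
      simp [ascPochhammer_succ_left, Polynomial.eval_comp]
    rw [sum_antidiagonal_choose_succ_mul
      (fun i _ => (-1) ^ i * (ascPochhammer ℝ i).eval a / (ascPochhammer ℝ i).eval c), ih a c hc]
    have hshift : ∑ p ∈ antidiagonal k, (k.choose p.2 : ℝ) *
        ((-1) ^ (p.1 + 1) * (ascPochhammer ℝ (p.1 + 1)).eval a /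
          (ascPochhammer ℝ (p.1 + 1)).eval c) =
        -(a / c) * ((ascPochhammer ℝ k).eval (c - a) / (ascPochhammer ℝ k).eval (c + 1)) := by
      have := ih (a + 1) (c + 1) (by linarith)
      rw [add_sub_add_right_eq_sub] at this
      rw [← this, mul_sum]
      refine sum_congr rfl fun p hp => ?_
      rw [hsplit, hsplit, ← Nat.choose_symm_of_eq_add (mem_antidiagonal.mp hp).symm, pow_succ]
      have := (ascPochhammer_pos p.1 (c + 1) (by linarith)).ne'
      field_simp
    rw [hshift]
    have h1 := hsplit k c
    rw [ascPochhammer_succ_eval] at h1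
    have hk := (ascPochhammer_pos k c hc).ne'
    have hk' := (ascPochhammer_pos k (c + 1) (by linarith)).ne'
    have hck : c + k ≠ 0 := by positivity
    rw [ascPochhammer_succ_eval, ascPochhammer_succ_eval]
    have h2 : (ascPochhammer ℝ k).eval (c + 1) = (ascPochhammer ℝ k).eval c * (c + k) / c := by
      field_simp; linarith
    rw [h2]
    field_simp
    ring

theorem ascPochhammer_eval_one_sub_sub (k : ℕ) (x : ℝ) :
    (ascPochhammer ℝ k).eval (1 - x - k) = (-1) ^ k * (ascPochhammer ℝ k).eval x := by
  have h := descPochhammer_eval_eq_ascPochhammer ℝ (-x) k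
  rw [show -x - k + 1 = 1 - x - k by ring] at h
  have h' := ascPochhammer_eval_neg_eq_descPochhammer ℝ (-x) k
  rw [neg_neg] at h'
  rw [← h, h', ← mul_assoc, ← mul_pow]
  simp

theorem ascPochhammer_eval_add (m n : ℕ) (x : ℝ) :
    (ascPochhammer ℝ (m + n)).eval x =
      (ascPochhammer ℝ m).eval x * (ascPochhammer ℝ n).eval (x + m) := by
  simp [← ascPochhammer_mul, Polynomial.eval_comp]

theorem choose_add_sub_one_eq (a : ℝ) (n : ℕ) :
    Ring.choose (a + n - 1) n = (ascPochhammer ℝ n).eval a / n.factorial := by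
  rw [Ring.choose_eq_smul, Polynomial.descPochhammer_smeval_eq_ascPochhammer,
    Polynomial.ascPochhammer_smeval_cast, Polynomial.ascPochhammer_smeval_eq_eval]
  rw [show a + n - 1 - n + 1 = a by ring]
  simp [div_eq_inv_mul]

theorem hasSum_one_sub_cpow_neg (ν : ℝ) {z : ℂ} (hz : ‖z‖ < 1) :
    HasSum (fun n : ℕ => (((ascPochhammer ℝ n).eval ν / n.factorial : ℝ) : ℂ) * z ^ n)
      ((1 - z) ^ (-(ν : ℂ))) := by
  have h := (Complex.one_div_one_sub_cpow_hasFPowerSeriesOnBall_zero (ν : ℂ)).hasSum (y := z)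
    (by simpa [enorm_eq_nnnorm] using! hz)
  simp only [zero_add, one_div, ← Complex.cpow_neg] at h
  convert! h using 2 with n
  rw [← choose_add_sub_one_eq, Complex.ofReal_choose]
  simp [mul_comm]

theorem hasSum_one_sub_rpow_neg (ν : ℝ) {y : ℝ} (hy : |y| < 1) :
    HasSum (fun n : ℕ => (ascPochhammer ℝ n).eval ν / n.factorial * y ^ n)
      ((1 - y) ^ (-ν)) := by
  have h := hasSum_one_sub_cpow_neg ν (z := y) (by simpa using hy)
  have hy' : 0 ≤ 1 - y := by linarith [(abs_lt.mp hy).2]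
  rw [← Complex.ofReal_one, ← Complex.ofReal_sub, ← Complex.ofReal_neg,
    ← Complex.ofReal_cpow hy'] at h
  exact_mod_cast h

/-- The coefficients of `(1 + r ^ 2 - 2 * r * cos t) ^ (-ν)` as a power series in `r`. -/
noncomputable def gegenbauerCos (ν : ℝ) (n : ℕ) (t : ℝ) : ℝ :=
  ∑ p ∈ Finset.HasAntidiagonal.antidiagonal n, ((ascPochhammer ℝ p.1).eval ν / p.1.factorial) *
    ((ascPochhammer ℝ p.2).eval ν / p.2.factorial) * cos ((p.1 - p.2 : ℝ) * t)

theorem continuous_gegenbauerCos (ν : ℝ) (n : ℕ) : Continuous (gegenbauerCos ν n) := by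
  unfold gegenbauerCos
  fun_prop

theorem abs_gegenbauerCos_le {ν : ℝ} (hν : 0 < ν) (n : ℕ) (t : ℝ) :
    |gegenbauerCos ν n t| ≤ gegenbauerCos ν n 0 := by
  unfold gegenbauerCos
  refine (Finset.abs_sum_le_sum_abs _ _).trans (Finset.sum_le_sum fun p _ => ?_)
  have h1 := ascPochhammer_pos p.1 ν hν
  have h2 := ascPochhammer_pos p.2 ν hν
  rw [abs_mul, abs_of_nonneg (by positivity), mul_zero, cos_zero]
  exact mul_le_mul_of_nonneg_left (abs_cos_le_one _) (by positivity)

theorem one_add_sq_sub_pos {r : ℝ} (hr : |r| < 1) (t : ℝ) :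
    0 < 1 + r ^ 2 - 2 * r * cos t := by
  have h1 : |r * cos t| ≤ |r| := by
    rw [abs_mul]; exact mul_le_of_le_one_right (abs_nonneg _) (abs_cos_le_one t)
  nlinarith [le_abs_self (r * cos t), sq_abs r, sq_pos_of_pos (sub_pos.mpr hr)]

theorem hasSum_gegenbauerCos (ν : ℝ) {r : ℝ} (hr : |r| < 1) (t : ℝ) :
    HasSum (fun n : ℕ => gegenbauerCos ν n t * r ^ n)
      ((1 + r ^ 2 - 2 * r * cos t) ^ (-ν)) := by
  set z : ℂ := r * Complex.exp (t * Complex.I) with hz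
  have hnz : ‖z‖ < 1 := by simpa [hz, Complex.norm_exp_ofReal_mul_I] using hr
  have hnz' : ‖(starRingEnd ℂ) z‖ < 1 := by rwa [RCLike.norm_conj]
  have hA := hasSum_one_sub_cpow_neg ν hnz
  have hB := hasSum_one_sub_cpow_neg ν hnz'
  have hprod := summable_norm_sum_mul_antidiagonal_of_summable_norm hA.summable.norm
    hB.summable.norm
  have hsum : HasSum _ _ := hprod.of_norm.hasSum
  rw [← tsum_mul_tsum_eq_tsum_sum_antidiagonal_of_summable_norm hA.summable.norm
    hB.summable.norm, hA.tsum_eq, hB.tsum_eq] at hsum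
  have hre := Complex.hasSum_re hsum
  convert hre using 1
  · ext n
    rw [gegenbauerCos, Finset.sum_mul, Complex.re_sum]
    refine Finset.sum_congr rfl fun p hp => ?_
    have hconj : (starRingEnd ℂ) z = r * Complex.exp (-(t * Complex.I)) := by
      rw [hz, map_mul, Complex.conj_ofReal, ← Complex.exp_conj]; simp
    have : z ^ p.1 * (starRingEnd ℂ) z ^ p.2 =
        ((r ^ n : ℝ) : ℂ) * Complex.exp (((p.1 - p.2 : ℝ) * t : ℝ) * Complex.I) := by
      rw [hconj, hz, mul_pow, mul_pow, ← Complex.exp_nat_mul, ← Complex.exp_nat_mul,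
        ← Finset.HasAntidiagonal.mem_antidiagonal.mp hp, mul_mul_mul_comm, ← Complex.exp_add, ← pow_add]
      push_cast
      ring_nf
    rw [mul_mul_mul_comm, this, ← Complex.ofReal_mul, Complex.re_ofReal_mul,
      Complex.re_ofReal_mul, Complex.exp_ofReal_mul_I_re]
    ring
  · have hne : 1 - z ∈ Complex.slitPlane := by
      have := Complex.mem_slitPlane_of_norm_lt_one (z := -z) (by simpa using hnz)
      simpa [sub_eq_add_neg] using this
    have hc : (1 - (starRingEnd ℂ) z) ^ (-(ν : ℂ)) =
        (starRingEnd ℂ) ((1 - z) ^ (-(ν : ℂ))) := by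
      have := Complex.conj_cpow (1 - z) (-(ν : ℂ)) (Complex.mem_slitPlane_iff_arg.mp hne).1
      simpa using this
    rw [hc, Complex.mul_conj, Complex.ofReal_re, Complex.normSq_eq_norm_sq,
      ← Complex.ofReal_neg, Complex.norm_cpow_real, Real.rpow_pow_comm (norm_nonneg _),
      ← Complex.normSq_eq_norm_sq]
    congr 1
    simp only [Complex.normSq_apply, hz, Complex.sub_re, Complex.sub_im, Complex.re_ofReal_mul,
      Complex.im_ofReal_mul, Complex.exp_ofReal_mul_I_re, Complex.exp_ofReal_mul_I_im,
      Complex.one_re, Complex.one_im]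
    nlinarith [sin_sq_add_cos_sq t]

/-- Term-by-term integration of the Gegenbauer expansion against a continuous weight. -/
theorem hasSum_integral_gegenbauerCos {ν : ℝ} (hν : 0 < ν) {w : ℝ → ℝ} (hw : Continuous w)
    {r : ℝ} (hr : |r| < 1) :
    HasSum (fun n : ℕ => (∫ t in (0 : ℝ)..π, w t * gegenbauerCos ν n t) * r ^ n)
      (∫ t in (0 : ℝ)..π, w t * (1 + r ^ 2 - 2 * r * cos t) ^ (-ν)) := by
  have hb : Summable fun n : ℕ => gegenbauerCos ν n 0 * |r| ^ n :=
    (hasSum_gegenbauerCos ν (r := |r|) (by simpa using hr) 0).summable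
  have := intervalIntegral.hasSum_integral_of_dominated_convergence (μ := volume) (a := 0) (b := π)
    (F := fun n t => w t * gegenbauerCos ν n t * r ^ n)
    (f := fun t => w t * (1 + r ^ 2 - 2 * r * cos t) ^ (-ν))
    (fun n t => |w t| * (gegenbauerCos ν n 0 * |r| ^ n))
    (fun n => ((hw.mul (continuous_gegenbauerCos ν n)).mul_const _).aestronglyMeasurable)
    (fun n => Filter.Eventually.of_forall fun t _ => by
      rw [norm_eq_abs, abs_mul, abs_mul, abs_pow, mul_assoc]
      gcongr
      exact abs_gegenbauerCos_le hν n t)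
    (Filter.Eventually.of_forall fun t _ => hb.mul_left _)
    (by
      simp_rw [tsum_mul_left]
      exact (hw.abs.mul_const _).intervalIntegrable _ _)
    (Filter.Eventually.of_forall fun t _ => by
      simp only [mul_assoc (w t)]
      exact (hasSum_gegenbauerCos ν hr t).mul_left _)
  simpa only [intervalIntegral.integral_mul_const] using this

theorem integral_sin_rpow {μ : ℝ} (hμ : 0 < μ) :
    ∫ t in (0 : ℝ)..π, sin t ^ (2 * μ - 1) = betaFn μ (1 / 2) := by
  have hinj : Set.InjOn (fun t : ℝ => (1 - cos t) / 2) (Set.Ioo 0 π) := fun x hx y hy h =>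
    injOn_cos ⟨hx.1.le, hx.2.le⟩ ⟨hy.1.le, hy.2.le⟩ (by simp only at h; linarith)
  have himg : (fun t : ℝ => (1 - cos t) / 2) '' Set.Ioo 0 π = Set.Ioo 0 1 := by
    ext x
    constructor
    · rintro ⟨t, ht, rfl⟩
      have h1 := cos_lt_cos_of_nonneg_of_le_pi le_rfl ht.2.le ht.1
      have h2 := cos_lt_cos_of_nonneg_of_le_pi ht.1.le le_rfl ht.2
      rw [cos_zero] at h1
      rw [cos_pi] at h2
      constructor <;> simp only <;> linarith
    · rintro ⟨h0, h1⟩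
      refine ⟨arccos (1 - 2 * x), ⟨arccos_pos.mpr (by linarith), ?_⟩, ?_⟩
      · refine lt_of_le_of_ne (arccos_le_pi _) fun h => ?_
        rw [arccos_eq_pi] at h
        linarith
      · simp only
        rw [cos_arccos (by linarith) (by linarith)]
        ring
  have hcov := integral_image_eq_integral_abs_deriv_smul (s := Set.Ioo 0 π) measurableSet_Ioo
    (f := fun t : ℝ => (1 - cos t) / 2) (f' := fun t => sin t / 2)
    (fun t _ => by
      have := (((hasDerivAt_cos t).const_sub 1).div_const 2).hasDerivWithinAt (s := Set.Ioo 0 π)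
      simpa using this) hinj
    (fun x : ℝ => x ^ (μ - 1) * (1 - x) ^ (μ - 1))
  rw [himg] at hcov
  have hbeta : ∫ x in Set.Ioo (0 : ℝ) 1, x ^ (μ - 1) * (1 - x) ^ (μ - 1) =
      ProbabilityTheory.beta μ μ := by
    rw [ProbabilityTheory.beta_eq_betaIntegralReal μ μ hμ hμ, Complex.betaIntegral,
      intervalIntegral.integral_of_le zero_le_one, integral_Ioc_eq_integral_Ioo]
    rw [← Complex.ofReal_re (∫ x in Set.Ioo (0 : ℝ) 1, x ^ (μ - 1) * (1 - x) ^ (μ - 1)),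
      ← integral_complex_ofReal]
    congr 1
    refine setIntegral_congr_fun measurableSet_Ioo fun x hx => ?_
    rw [Complex.ofReal_mul, Complex.ofReal_cpow hx.1.le, Complex.ofReal_cpow (by linarith [hx.2])]
    push_cast
    rfl
  have hsin : ∫ t in Set.Ioo (0 : ℝ) π, |sin t / 2| •
      (((1 - cos t) / 2) ^ (μ - 1) * (1 - (1 - cos t) / 2) ^ (μ - 1)) =
      ∫ t in Set.Ioo (0 : ℝ) π, sin t ^ (2 * μ - 1) * (2⁻¹ : ℝ) ^ (2 * μ - 1) := by
    refine setIntegral_congr_fun measurableSet_Ioo fun t ht => ?_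
    have hs := sin_pos_of_pos_of_lt_pi ht.1 ht.2
    rw [abs_of_pos (by positivity), smul_eq_mul, ← mul_rpow
      (by linarith [cos_le_one t]) (by linarith [neg_one_le_cos t]),
      show (1 - cos t) / 2 * (1 - (1 - cos t) / 2) = (sin t / 2) ^ 2 by
        nlinarith [sin_sq_add_cos_sq t], ← rpow_natCast, ← rpow_mul (by positivity),
      ← mul_rpow hs.le (by positivity), ← div_eq_mul_inv]
    nth_rewrite 1 [← rpow_one (sin t / 2)]
    rw [← rpow_add (by positivity)]
    congr 1
    push_cast
    ring
  rw [hsin, hbeta, integral_mul_const] at hcov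
  rw [intervalIntegral.integral_of_le pi_pos.le, integral_Ioc_eq_integral_Ioo]
  have hdup := Real.Gamma_mul_Gamma_add_half μ
  have h1 := (Gamma_pos_of_pos hμ).ne'
  have h2 := (Gamma_pos_of_pos (show 0 < μ + 1 / 2 by linarith)).ne'
  have h3 := (Gamma_pos_of_pos (show 0 < 2 * μ by linarith)).ne'
  have h4 : (2⁻¹ : ℝ) ^ (2 * μ - 1) = 2 ^ (1 - 2 * μ) := by
    rw [inv_rpow (by norm_num), ← rpow_neg (by norm_num)]; congr 1; ring
  have h5 : (0 : ℝ) < 2 ^ (1 - 2 * μ) := by positivity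
  rw [h4, ProbabilityTheory.beta, ← two_mul] at hcov
  rw [betaFn, Gamma_one_half_eq, eq_div_iff h2]
  rw [div_eq_iff h3] at hcov
  have : Gamma μ * (∫ t in Set.Ioo (0 : ℝ) π, sin t ^ (2 * μ - 1)) * Gamma (μ + 1 / 2) =
    Gamma μ * (Gamma μ * √π) := by
    rw [← mul_assoc, hcov]
    linear_combination (∫ t in Set.Ioo (0 : ℝ) π, sin t ^ (2 * μ - 1)) * hdup
  rw [mul_assoc] at this
  exact mul_left_cancel₀ h1 this

theorem integral_sin_rpow_mul_cos_pow_add_two {s : ℝ} (hs : 0 < s) (p : ℕ) :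
    (s + p + 2) * ∫ t in (0 : ℝ)..π, sin t ^ s * cos t ^ (p + 2) =
      (p + 1) * ∫ t in (0 : ℝ)..π, sin t ^ s * cos t ^ p := by
  have hc : ∀ q : ℕ, Continuous fun t : ℝ => sin t ^ s * cos t ^ q := fun q =>
    (continuous_sin.rpow_const fun _ => Or.inr hs.le).mul (continuous_cos.pow q)
  have hderiv : ∀ t ∈ Set.uIcc 0 π, HasDerivAt (fun t : ℝ => sin t ^ (s + 1) * cos t ^ (p + 1))
      ((s + p + 2) * (sin t ^ s * cos t ^ (p + 2)) - (p + 1) * (sin t ^ s * cos t ^ p)) t := by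
    intro t ht
    rw [Set.uIcc_of_le pi_pos.le] at ht
    have h0 : 0 ≤ sin t := sin_nonneg_of_mem_Icc ht
    convert! ((hasDerivAt_sin t).rpow_const (p := s + 1) (Or.inr (by linarith))).mul
      ((hasDerivAt_cos t).pow (p + 1)) using 1
    rw [add_sub_cancel_right, rpow_add_one' h0 (by linarith)]
    have : sin t * sin t = 1 - cos t ^ 2 := by nlinarith [sin_sq_add_cos_sq t]
    push_cast
    rw [Pi.pow_apply]
    linear_combination ((p + 1) * sin t ^ s * cos t ^ p) * this
  have h := intervalIntegral.integral_eq_sub_of_hasDerivAt hderiv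
    ((((hc _).const_mul _).sub ((hc _).const_mul _)).intervalIntegrable _ _)
  rw [intervalIntegral.integral_sub (((hc _).const_mul _).intervalIntegrable _ _)
    (((hc _).const_mul _).intervalIntegrable _ _), intervalIntegral.integral_const_mul,
    intervalIntegral.integral_const_mul] at h
  simp only [sin_zero, sin_pi, zero_rpow (show s + 1 ≠ 0 by linarith), zero_mul, sub_zero] at h
  linarith

theorem integral_sin_rpow_mul_cos_pow_odd (s : ℝ) (j : ℕ) :
    ∫ t in (0 : ℝ)..π, sin t ^ s * cos t ^ (2 * j + 1) = 0 := by
  have h := intervalIntegral.integral_comp_sub_left (a := 0) (b := π)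
    (fun t : ℝ => sin t ^ s * cos t ^ (2 * j + 1)) π
  simp only [sin_pi_sub, cos_pi_sub, sub_zero, sub_self, (odd_two_mul_add_one j).neg_pow, mul_neg,
    intervalIntegral.integral_neg] at h
  linarith

theorem integral_sin_rpow_mul_cos_pow_even {μ : ℝ} (hμ : 1 < 2 * μ) (j : ℕ) :
    (∫ t in (0 : ℝ)..π, sin t ^ (2 * μ - 1) * cos t ^ (2 * j)) * 4 ^ j / (2 * j).factorial =
      betaFn μ (1 / 2) / (j.factorial * (ascPochhammer ℝ j).eval (μ + 1 / 2)) := by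
  induction j with
  | zero => simpa using integral_sin_rpow (by linarith)
  | succ j ih =>
    have h := integral_sin_rpow_mul_cos_pow_add_two (show 0 < 2 * μ - 1 by linarith) (2 * j)
    have hP := (ascPochhammer_pos j (μ + 1 / 2) (by linarith)).ne'
    have hne : μ + 1 / 2 + j ≠ 0 := by
      have : (0 : ℝ) ≤ j := by positivity
      linarith
    have hj : ((2 * j).factorial : ℝ) ≠ 0 := by positivity
    have hj' : (j.factorial : ℝ) ≠ 0 := by positivity
    rw [show 2 * (j + 1) = 2 * j + 2 by ring, ascPochhammer_succ_eval, Nat.factorial_succ,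
      Nat.factorial_succ, Nat.factorial_succ, pow_succ]
    generalize (ascPochhammer ℝ j).eval (μ + 1 / 2) = P at ih hP ⊢
    push_cast at h ⊢
    set M := ∫ t in (0 : ℝ)..π, sin t ^ (2 * μ - 1) * cos t ^ (2 * j)
    set M' := ∫ t in (0 : ℝ)..π, sin t ^ (2 * μ - 1) * cos t ^ (2 * j + 2)
    have hM : M' = (2 * j + 1) * M / (2 * (μ + 1 / 2 + j)) := by
      rw [eq_div_iff (by positivity)]; linarith
    have hB : betaFn μ (1 / 2) = M * 4 ^ j / (2 * j).factorial *
        (j.factorial * P) := by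
      rw [ih]; field_simp
    rw [hM, hB]
    field_simp
    ring

open Finset in
theorem HasSum.sum_antidiagonal {f : ℕ × ℕ → ℝ} {a : ℝ} (h : HasSum f a) :
    HasSum (fun n => ∑ p ∈ antidiagonal n, f p) a := by
  refine ((HasAntidiagonal.sigmaAntidiagonalEquivProd (A := ℕ)).hasSum_iff.mpr h).sigma
    fun n => ?_
  rw [← sum_attach]
  exact hasSum_fintype _

/-- The coefficients of `(1 - (u + v)) ^ (-ν)` as a power series in `u` and `v`. -/
noncomputable def multinomialCoeff (ν : ℝ) (p : ℕ × ℕ) : ℝ :=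
  (ascPochhammer ℝ (p.1 + p.2)).eval ν / (p.1.factorial * p.2.factorial)

theorem multinomialCoeff_pos {ν : ℝ} (hν : 0 < ν) (p : ℕ × ℕ) : 0 < multinomialCoeff ν p := by
  have := ascPochhammer_pos (p.1 + p.2) ν hν
  unfold multinomialCoeff
  positivity

open Finset in
theorem sum_antidiagonal_multinomialCoeff (ν u v : ℝ) (n : ℕ) :
    ∑ p ∈ antidiagonal n, multinomialCoeff ν p * (u ^ p.1 * v ^ p.2) =
      (ascPochhammer ℝ n).eval ν / n.factorial * (u + v) ^ n := by
  rw [(Commute.all u v).add_pow', mul_sum]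
  refine sum_congr rfl fun p hp => ?_
  rw [HasAntidiagonal.mem_antidiagonal] at hp
  have h := Nat.add_choose_mul_factorial_mul_factorial p.1 p.2
  rw [hp, ← Nat.choose_symm_of_eq_add hp.symm] at h
  have h' : ((n.choose p.1 : ℝ)) * p.1.factorial * p.2.factorial = n.factorial := mod_cast h
  rw [multinomialCoeff, hp, ← h', nsmul_eq_mul]
  have : (n.choose p.1 : ℝ) ≠ 0 := by
    exact_mod_cast (Nat.choose_pos (by omega)).ne'
  field_simp

theorem summable_multinomialCoeff {ν u v : ℝ} (hν : 0 < ν) (hu : 0 ≤ u) (hv : 0 ≤ v)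
    (h : u + v < 1) :
    Summable fun p : ℕ × ℕ => multinomialCoeff ν p * (u ^ p.1 * v ^ p.2) := by
  rw [← (Finset.HasAntidiagonal.sigmaAntidiagonalEquivProd (A := ℕ)).summable_iff]
  refine (summable_sigma_of_nonneg fun x => ?_).mpr ⟨fun n => (hasSum_fintype _).summable, ?_⟩
  · have := multinomialCoeff_pos hν (Finset.HasAntidiagonal.sigmaAntidiagonalEquivProd x)
    simp only [Function.comp]
    positivity
  · have hs := (hasSum_one_sub_rpow_neg ν (y := u + v)
      (by rwa [abs_of_nonneg (by positivity)])).summable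
    convert! hs using 2 with n
    rw [← sum_antidiagonal_multinomialCoeff, ← Finset.sum_attach, tsum_fintype]
    rfl

theorem hasSum_multinomialCoeff {ν u v : ℝ} (hν : 0 < ν) (h : |u| + |v| < 1) :
    HasSum (fun p : ℕ × ℕ => multinomialCoeff ν p * (u ^ p.1 * v ^ p.2))
      ((1 - (u + v)) ^ (-ν)) := by
  have hs : Summable fun p : ℕ × ℕ => multinomialCoeff ν p * (u ^ p.1 * v ^ p.2) := by
    refine Summable.of_norm ?_
    convert! summable_multinomialCoeff hν (abs_nonneg u) (abs_nonneg v) h using 2 with p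
    rw [norm_eq_abs, abs_mul, abs_mul, abs_pow, abs_pow,
      abs_of_pos (multinomialCoeff_pos hν p)]
  have h1 := hs.hasSum.sum_antidiagonal
  simp only [sum_antidiagonal_multinomialCoeff] at h1
  have h2 := hasSum_one_sub_rpow_neg ν (y := u + v) ((abs_add_le u v).trans_lt h)
  rw [← h1.unique h2]
  exact hs.hasSum

theorem hasSum_integral_multinomialCoeff {ν : ℝ} (hν : 0 < ν) {w : ℝ → ℝ} (hw : Continuous w)
    {r : ℝ} (hr : |r| < 1 / 4) :
    HasSum (fun p : ℕ × ℕ => (∫ t in (0 : ℝ)..π, w t * cos t ^ p.1) *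
        (multinomialCoeff ν p * ((2 * r) ^ p.1 * (-r ^ 2) ^ p.2)))
      (∫ t in (0 : ℝ)..π, w t * (1 + r ^ 2 - 2 * r * cos t) ^ (-ν)) := by
  have hr2 : |2 * r| + |-r ^ 2| < 1 := by
    rw [abs_neg, abs_mul, abs_pow, abs_two]
    nlinarith [abs_nonneg r]
  have hb : Summable fun p : ℕ × ℕ => multinomialCoeff ν p * (|2 * r| ^ p.1 * |-r ^ 2| ^ p.2) :=
    summable_multinomialCoeff hν (abs_nonneg _) (abs_nonneg _) hr2
  have := intervalIntegral.hasSum_integral_of_dominated_convergence (μ := volume) (a := 0) (b := π)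
    (F := fun (p : ℕ × ℕ) t => w t * cos t ^ p.1 *
      (multinomialCoeff ν p * ((2 * r) ^ p.1 * (-r ^ 2) ^ p.2)))
    (f := fun t => w t * (1 + r ^ 2 - 2 * r * cos t) ^ (-ν))
    (fun p t => |w t| * (multinomialCoeff ν p * (|2 * r| ^ p.1 * |-r ^ 2| ^ p.2)))
    (fun p => ((hw.mul (continuous_cos.pow p.1)).mul_const _).aestronglyMeasurable)
    (fun p => Filter.Eventually.of_forall fun t _ => by
      have hp := multinomialCoeff_pos hν p
      rw [norm_eq_abs, abs_mul, abs_mul, abs_mul, abs_mul, abs_pow, abs_pow, abs_pow,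
        abs_of_pos hp]
      refine mul_le_mul_of_nonneg_right ?_ (by positivity)
      exact mul_le_of_le_one_right (abs_nonneg _)
        (pow_le_one₀ (abs_nonneg _) (abs_cos_le_one t)))
    (Filter.Eventually.of_forall fun t _ => hb.mul_left _)
    (by
      simp_rw [tsum_mul_left]
      exact (hw.abs.mul_const _).intervalIntegrable _ _)
    (Filter.Eventually.of_forall fun t _ => by
      have h : |2 * r * cos t| + |-r ^ 2| < 1 := by
        refine lt_of_le_of_lt ?_ hr2
        rw [abs_mul (2 * r)]
        gcongr
        exact mul_le_of_le_one_right (abs_nonneg _) (abs_cos_le_one t)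
      convert! (hasSum_multinomialCoeff hν h).mul_left (w t) using 2 with p
      · rw [mul_pow (2 * r)]; ring
      · congr 1; ring)
  simpa only [intervalIntegral.integral_mul_const] using this

open Finset in
theorem sum_antidiagonal_moment_mul_multinomialCoeff {μ : ℝ} (hμ : 1 < 2 * μ) (ν r : ℝ) (k : ℕ) :
    ∑ p ∈ antidiagonal k,
      (∫ t in (0 : ℝ)..π, sin t ^ (2 * μ - 1) * cos t ^ (2 * p.1)) *
        (multinomialCoeff ν (2 * p.1, p.2) * ((2 * r) ^ (2 * p.1) * (-r ^ 2) ^ p.2)) =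
      betaFn μ (1 / 2) * ((ascPochhammer ℝ k).eval ν *
        (ascPochhammer ℝ k).eval (ν + 1 / 2 - μ) /
        ((ascPochhammer ℝ k).eval (μ + 1 / 2) * k.factorial)) * r ^ (2 * k) := by
  have hV := sum_choose_mul_ascPochhammer_div k (ν + k) (μ + 1 / 2) (by linarith)
  have hR := ascPochhammer_eval_one_sub_sub k (ν + 1 / 2 - μ)
  rw [show 1 - (ν + 1 / 2 - μ) - k = μ + 1 / 2 - (ν + k) by ring] at hR
  rw [hR] at hV
  have hsq : ((-1 : ℝ) ^ k) * (-1) ^ k = 1 := by rw [← mul_pow]; simp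
  trans betaFn μ (1 / 2) * (ascPochhammer ℝ k).eval ν * (-1) ^ k / k.factorial * r ^ (2 * k) *
      ((-1) ^ k * (ascPochhammer ℝ k).eval (ν + 1 / 2 - μ) / (ascPochhammer ℝ k).eval (μ + 1 / 2))
  · rw [← hV, mul_sum]
    refine sum_congr rfl fun p hp => ?_
    rw [HasAntidiagonal.mem_antidiagonal] at hp
    have hM := integral_sin_rpow_mul_cos_pow_even hμ p.1
    have hC := Nat.add_choose_mul_factorial_mul_factorial p.1 p.2
    rw [hp, ← Nat.choose_symm_of_eq_add hp.symm] at hC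
    have hC' : (k.choose p.1 : ℝ) = k.factorial / (p.1.factorial * p.2.factorial) := by
      rw [eq_div_iff (by positivity), ← mul_assoc]
      exact_mod_cast hC
    have hpow : (2 * r) ^ (2 * p.1) * (-r ^ 2) ^ p.2 =
        4 ^ p.1 * ((-1) ^ k * (-1) ^ p.1) * r ^ (2 * k) := by
      have hsq' : ((-1 : ℝ) ^ p.1) * (-1) ^ p.1 = 1 := by rw [← mul_pow]; simp
      rw [pow_mul (2 * r), neg_pow, ← hp, pow_add (-1 : ℝ), mul_add, pow_add r, pow_mul r 2 p.1,
        pow_mul r 2 p.2, mul_pow 2 r, mul_pow]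
      norm_num
      linear_combination (-(4 ^ p.1 * (-1) ^ p.2 * (r ^ 2) ^ p.1 * (r ^ 2) ^ p.2)) * hsq'
    have hP : (ascPochhammer ℝ (2 * p.1 + p.2)).eval ν =
        (ascPochhammer ℝ k).eval ν * (ascPochhammer ℝ p.1).eval (ν + k) := by
      rw [← ascPochhammer_eval_add]
      congr 2
      omega
    rw [hpow, multinomialCoeff, hP, hC']
    have hk : (k.factorial : ℝ) ≠ 0 := by positivity
    trans (∫ t in (0 : ℝ)..π, sin t ^ (2 * μ - 1) * cos t ^ (2 * p.1)) * 4 ^ p.1 /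
        (2 * p.1).factorial * ((ascPochhammer ℝ k).eval ν * (ascPochhammer ℝ p.1).eval (ν + k) /
          p.2.factorial * ((-1) ^ k * (-1) ^ p.1) * r ^ (2 * k))
    · field_simp
    · rw [hM]
      field_simp
  · linear_combination (betaFn μ (1 / 2) * ((ascPochhammer ℝ k).eval ν *
        (ascPochhammer ℝ k).eval (ν + 1 / 2 - μ) /
        ((ascPochhammer ℝ k).eval (μ + 1 / 2) * k.factorial)) * r ^ (2 * k)) * hsq

theorem coeff_eq_of_hasSum_near_zero {c d : ℕ → ℝ} {f : ℝ → ℝ} {ρ : ℝ} (hρ : 0 < ρ)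
    (hc : ∀ r, |r| < ρ → HasSum (fun n => c n * r ^ n) (f r))
    (hd : ∀ r, |r| < ρ → HasSum (fun n => d n * r ^ n) (f r)) : c = d := by
  have key : ∀ e : ℕ → ℝ, (∀ r, |r| < ρ → HasSum (fun n => e n * r ^ n) (f r)) →
      HasFPowerSeriesAt f (FormalMultilinearSeries.ofScalars ℝ e) 0 := fun e he => by
    rw [hasFPowerSeriesAt_iff]
    filter_upwards [Metric.ball_mem_nhds (0 : ℝ) hρ] with r hr
    have := he r (by simpa using hr)
    simpa [FormalMultilinearSeries.coeff_ofScalars, mul_comm] using this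
  have h := (key c hc).eq_formalMultilinearSeries (key d hd)
  ext n
  simpa [FormalMultilinearSeries.coeff_ofScalars] using
    congrArg (fun p : FormalMultilinearSeries ℝ ℝ ℝ => p.coeff n) h

theorem hasSum_even_iff {h : ℕ → ℝ} {r a : ℝ} :
    HasSum (fun n => (if Even n then h (n / 2) else 0) * r ^ n) a ↔
      HasSum (fun k => h k * r ^ (2 * k)) a := by
  have hinj : Function.Injective fun k : ℕ => 2 * k := fun a b hab => by simpa using hab
  rw [← hinj.hasSum_iff]
  · simp [Function.comp_def]
  · intro n hn
    have : ¬ Even n := fun ⟨m, hm⟩ => hn ⟨m, by simp only; omega⟩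
    simp [this]

theorem hasSum_integral_near_zero {μ ν : ℝ} (hμ : 1 < 2 * μ) (hν : 0 < ν) {r : ℝ}
    (hr : |r| < 1 / 4) :
    HasSum (fun k : ℕ => betaFn μ (1 / 2) * ((ascPochhammer ℝ k).eval ν *
        (ascPochhammer ℝ k).eval (ν + 1 / 2 - μ) /
        ((ascPochhammer ℝ k).eval (μ + 1 / 2) * k.factorial)) * r ^ (2 * k))
      (∫ t in (0 : ℝ)..π, sin t ^ (2 * μ - 1) * (1 + r ^ 2 - 2 * r * cos t) ^ (-ν)) := by
  have hw : Continuous fun t => sin t ^ (2 * μ - 1) :=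
    continuous_sin.rpow_const fun _ => Or.inr (by linarith)
  have h := hasSum_integral_multinomialCoeff hν hw hr
  have hinj : Function.Injective fun p : ℕ × ℕ => (2 * p.1, p.2) := fun p q hpq => by
    simpa [Prod.ext_iff] using hpq
  rw [← hinj.hasSum_iff] at h
  · have h' := h.sum_antidiagonal
    simp only [Function.comp_def] at h'
    simpa only [sum_antidiagonal_moment_mul_multinomialCoeff hμ] using h'
  · rintro ⟨p, i⟩ hp
    obtain ⟨j, rfl | rfl⟩ := Nat.even_or_odd' p
    · exact absurd ⟨(j, i), rfl⟩ hp
    · rw [integral_sin_rpow_mul_cos_pow_odd, zero_mul]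

theorem hasSum_integral {μ ν : ℝ} (hμ : 1 < 2 * μ) (hν : 0 < ν) {r : ℝ} (hr : |r| < 1) :
    HasSum (fun k : ℕ => betaFn μ (1 / 2) * ((ascPochhammer ℝ k).eval ν *
        (ascPochhammer ℝ k).eval (ν + 1 / 2 - μ) /
        ((ascPochhammer ℝ k).eval (μ + 1 / 2) * k.factorial)) * r ^ (2 * k))
      (∫ t in (0 : ℝ)..π, sin t ^ (2 * μ - 1) * (1 + r ^ 2 - 2 * r * cos t) ^ (-ν)) := by
  have hw : Continuous fun t => sin t ^ (2 * μ - 1) :=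
    continuous_sin.rpow_const fun _ => Or.inr (by linarith)
  have hnear := fun (r : ℝ) (hr : |r| < 1 / 4) =>
    hasSum_even_iff.mpr (hasSum_integral_near_zero hμ hν hr)
  have hball := fun (r : ℝ) (hr : |r| < 1) => hasSum_integral_gegenbauerCos hν hw hr
  have hcoeff := coeff_eq_of_hasSum_near_zero (ρ := 1 / 4) (by norm_num)
    (f := fun r => ∫ t in (0 : ℝ)..π, sin t ^ (2 * μ - 1) *
      (1 + r ^ 2 - 2 * r * cos t) ^ (-ν))
    (fun r hr => hball r (hr.trans (by norm_num))) hnear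
  have hsum := hball r hr
  simp only [congrFun hcoeff] at hsum
  exact hasSum_even_iff.mp hsum

theorem stmt2 (l1 l2 r : ℝ) (h1 : 1 < l1) (h2 : 0 < l2) (hr : r ∈ Set.Ico (0 : ℝ) 1) :
    ∫ t in (0 : ℝ)..Real.pi,
        Real.sin t ^ (l1 - 1) / (1 + r ^ 2 - 2 * r * Real.cos t) ^ l2
      = betaFn (l1 / 2) (1 / 2) * hypF l2 (l2 + (1 - l1) / 2) ((1 + l1) / 2) (r ^ 2) := by
  have hr1 : |r| < 1 := by rw [abs_of_nonneg hr.1]; exact hr.2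
  have hsum := (hasSum_integral (show 1 < 2 * (l1 / 2) by linarith) h2 hr1).tsum_eq
  have hint : ∫ t in (0 : ℝ)..π, sin t ^ (l1 - 1) / (1 + r ^ 2 - 2 * r * cos t) ^ l2 =
      ∫ t in (0 : ℝ)..π, sin t ^ (2 * (l1 / 2) - 1) * (1 + r ^ 2 - 2 * r * cos t) ^ (-l2) := by
    refine intervalIntegral.integral_congr fun t _ => ?_
    rw [rpow_neg (one_add_sq_sub_pos hr1 t).le, div_eq_mul_inv, mul_div_cancel₀ l1 two_ne_zero]
  rw [hint, ← hsum, hypF, ← tsum_mul_left]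
  refine tsum_congr fun k => ?_
  rw [pow_mul, mul_assoc, show l2 + 1 / 2 - l1 / 2 = l2 + (1 - l1) / 2 by ring,
    show l1 / 2 + 1 / 2 = (1 + l1) / 2 by ring]
end

section
/- Let n ≥ 3 and G(x,y) the Green function of the unit ball B^n ⊂ ℝⁿ. Then for every x ∈ B^n, I₂(x) := ∫_{B^n} |∇_x G(x,y)| (1-|y|²) dV(y) ≤ δ(n), where δ(n) = ((n²-4)/(3(n²-1)))·c₀ + 4/(n(n+1)) and c₀ = max_{0≤t<1} (2-t²)(1+t). -/
open MeasureTheory Metric Real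

/-- Surface measure of the unit sphere `S^{n-1}`. -/
noncomputable def omegaS (n : ℕ) : ℝ := 2 * Real.pi ^ ((n : ℝ) / 2) / Real.Gamma ((n : ℝ) / 2)

/-- The quantity `[x,y] = | y|x| - x/|x| |`. -/
noncomputable def br {n : ℕ} (x y : EuclideanSpace ℝ (Fin n)) : ℝ :=
  ‖‖x‖ • y - ‖x‖⁻¹ • x‖

/-- The gradient in `x` of the Green function of the unit ball:
`∇_x G(x,y) = -(1/ω_{n-1})((x-y)/|x-y|^n - (|y|²x - y)/[x,y]^n)`. -/
noncomputable def gradGreen {n : ℕ} (x y : EuclideanSpace ℝ (Fin n)) :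
    EuclideanSpace ℝ (Fin n) :=
  -(1 / omegaS n) • ((‖x - y‖ ^ n)⁻¹ • (x - y) - (br x y ^ n)⁻¹ • (‖y‖ ^ 2 • x - y))

/-- `c₀ = max_{0 ≤ t < 1} (2-t²)(1+t)`. -/
noncomputable def cZero : ℝ := sSup ((fun t : ℝ => (2 - t ^ 2) * (1 + t)) '' Set.Ico 0 1)

/-- `δ(n) = ((n²-4)/(3(n²-1)))·c₀ + 4/(n(n+1))`. -/
noncomputable def deltaN (n : ℕ) : ℝ :=
  (((n : ℝ) ^ 2 - 4) / (3 * ((n : ℝ) ^ 2 - 1))) * cZero + 4 / ((n : ℝ) * (n + 1))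

section Polar

open Set Module
open scoped ENNReal RealInnerProductSpace

/-- Integration in polar coordinates for nonnegative functions. -/
theorem lintegral_eq_lintegral_toSphere {E : Type*} [NormedAddCommGroup E] [NormedSpace ℝ E]
    [MeasurableSpace E] [BorelSpace E] [FiniteDimensional ℝ E] [Nontrivial E]
    (μ : Measure E) [μ.IsAddHaarMeasure] {F : E → ℝ≥0∞} (hF : Measurable F) :
    ∫⁻ z, F z ∂μ = ∫⁻ η : sphere (0 : E) 1, (∫⁻ s in Ioi (0 : ℝ),
      ENNReal.ofReal (s ^ (finrank ℝ E - 1)) * F (s • (η : E))) ∂μ.toSphere := by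
  have hmeas : Measurable fun q : sphere (0 : E) 1 × Ioi (0 : ℝ) => F (q.2.1 • (q.1 : E)) :=
    hF.comp (by fun_prop)
  calc
    ∫⁻ z, F z ∂μ = ∫⁻ z : ({(0)}ᶜ : Set E), F z ∂(μ.comap (↑)) := by
      rw [lintegral_subtype_comap (measurableSet_singleton _).compl, restrict_compl_singleton]
    _ = ∫⁻ q, F (q.2.1 • (q.1 : E)) ∂μ.toSphere.prod (.volumeIoiPow (finrank ℝ E - 1)) := by
      rw [← μ.measurePreserving_homeomorphUnitSphereProd.lintegral_comp hmeas]
      refine lintegral_congr fun z => ?_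
      congr 1
      exact (congrArg Subtype.val ((homeomorphUnitSphereProd E).symm_apply_apply z)).symm
    _ = _ := by
      rw [lintegral_prod _ hmeas.aemeasurable]
      refine lintegral_congr fun η => ?_
      have hη : Measurable fun s : Ioi (0 : ℝ) => F (s.1 • (η : E)) := hF.comp (by fun_prop)
      rw [Measure.volumeIoiPow, lintegral_withDensity_eq_lintegral_mul _ (by fun_prop) hη,
        ← lintegral_subtype_comap measurableSet_Ioi]
      rfl

variable {E : Type*} [NormedAddCommGroup E] [InnerProductSpace ℝ E]
    [MeasurableSpace E] [BorelSpace E] [FiniteDimensional ℝ E]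

/-- The second moment of the surface measure in a direction depends only on the length. -/
theorem lintegral_toSphere_inner_sq_congr [Nontrivial E] {u v : E} (h : ‖u‖ = ‖v‖) :
    ∫⁻ η : sphere (0 : E) 1, ENNReal.ofReal (⟪u, (η : E)⟫ ^ 2) ∂(volume : Measure E).toSphere =
      ∫⁻ η : sphere (0 : E) 1, ENNReal.ofReal (⟪v, (η : E)⟫ ^ 2)
        ∂(volume : Measure E).toSphere := by
  set c : ℝ≥0∞ := ∫⁻ s in Ioi (0 : ℝ), ENNReal.ofReal (s ^ (finrank ℝ E - 1)) *
    (ENNReal.ofReal (s ^ 2) * (Iio (1 : ℝ)).indicator 1 s) with hc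
  have hc' : c = ENNReal.ofReal (∫ s in (0 : ℝ)..1, s ^ (finrank ℝ E - 1 + 2)) := by
    rw [intervalIntegral.integral_of_le zero_le_one, ofReal_integral_eq_lintegral_ofReal,
      Measure.restrict_congr_set Ioo_ae_eq_Ioc.symm, ← Ioi_inter_Iio, inter_comm,
      ← Measure.restrict_restrict measurableSet_Iio, ← lintegral_indicator measurableSet_Iio, hc]
    · refine setLIntegral_congr_fun measurableSet_Ioi fun s hs => ?_
      have hs : (0 : ℝ) < s := hs
      by_cases h1 : s < 1
      · simp [h1, pow_add, ENNReal.ofReal_mul (pow_nonneg hs.le (finrank ℝ E - 1))]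
      · simp [h1]
    · exact (intervalIntegral.intervalIntegrable_pow _).1
    · filter_upwards [ae_restrict_mem measurableSet_Ioc] with s hs
      exact pow_nonneg hs.1.le _
  have hc0 : c ≠ 0 := by
    rw [hc', integral_pow]
    simp
    positivity
  have hctop : c ≠ ∞ := by
    rw [hc']; simp
  have key (w : E) : ∫⁻ z : E, ENNReal.ofReal (⟪w, z⟫ ^ 2) * (ball (0 : E) 1).indicator 1 z =
      (∫⁻ η : sphere (0 : E) 1, ENNReal.ofReal (⟪w, (η : E)⟫ ^ 2)
        ∂(volume : Measure E).toSphere) * c := by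
    rw [lintegral_eq_lintegral_toSphere, ← lintegral_mul_const _ (by fun_prop)]
    · refine lintegral_congr fun η => ?_
      rw [hc, ← lintegral_const_mul]
      · refine setLIntegral_congr_fun measurableSet_Ioi fun s hs => ?_
        have hs : (0 : ℝ) < s := hs
        have hη : ‖(η : E)‖ = 1 := by simp
        have : (ball (0 : E) 1).indicator (1 : E → ℝ≥0∞) (s • (η : E)) =
            (Iio (1 : ℝ)).indicator 1 s := by
          simp [indicator, norm_smul, hη, abs_of_pos hs]
        rw [this, inner_smul_right, mul_pow, ENNReal.ofReal_mul (by positivity)]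
        ring
      · exact .mul (by fun_prop) (.mul (by fun_prop) (measurable_one.indicator measurableSet_Iio))
    · exact .mul (by fun_prop) (measurable_one.indicator measurableSet_ball)
  set A := (ℝ ∙ (u - v))ᗮ.reflection
  have hA : A u = v := Submodule.reflection_sub h
  have : ∫⁻ z : E, ENNReal.ofReal (⟪u, z⟫ ^ 2) * (ball (0 : E) 1).indicator 1 z =
      ∫⁻ z : E, ENNReal.ofReal (⟪v, z⟫ ^ 2) * (ball (0 : E) 1).indicator 1 z := by
    have hm : Measurable fun z : E =>
        ENNReal.ofReal (⟪v, z⟫ ^ 2) * (ball (0 : E) 1).indicator 1 z :=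
      .mul (by fun_prop) (measurable_one.indicator measurableSet_ball)
    rw [← A.measurePreserving.lintegral_comp hm, ← hA]
    refine lintegral_congr fun z => ?_
    simp [indicator, A.inner_map_map]
  rw [key, key] at this
  exact (ENNReal.mul_left_inj hc0 hctop).1 this

theorem finrank_mul_lintegral_toSphere_inner_sq [Nontrivial E] (v : E) :
    (finrank ℝ E : ℝ≥0∞) * ∫⁻ η : sphere (0 : E) 1, ENNReal.ofReal (⟪v, (η : E)⟫ ^ 2)
        ∂(volume : Measure E).toSphere =
      ENNReal.ofReal (‖v‖ ^ 2) * (volume : Measure E).toSphere univ := by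
  let b := stdOrthonormalBasis ℝ E
  calc
    _ = ∑ i : Fin (finrank ℝ E), ∫⁻ η : sphere (0 : E) 1,
        ENNReal.ofReal (⟪‖v‖ • b i, (η : E)⟫ ^ 2) ∂(volume : Measure E).toSphere := by
      rw [Finset.sum_congr rfl fun i _ => lintegral_toSphere_inner_sq_congr (u := ‖v‖ • b i)
        (v := v) (by simp [norm_smul])]
      simp
    _ = ∫⁻ η : sphere (0 : E) 1, ENNReal.ofReal (‖v‖ ^ 2) ∂(volume : Measure E).toSphere := by
      rw [← lintegral_finsetSum _ fun i _ => by fun_prop]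
      refine lintegral_congr fun η => ?_
      rw [← ENNReal.ofReal_sum_of_nonneg fun i _ => by positivity]
      simp only [inner_smul_left, mul_pow, ← Finset.mul_sum, b.sum_sq_inner_right]
      simp
    _ = _ := by simp

theorem lintegral_Ioi_one_sub_sq_le (p : ℝ) :
    ∫⁻ s in Ioi (0 : ℝ), (ENNReal.ofReal (1 - (p + s) ^ 2) + ENNReal.ofReal (1 - (p - s) ^ 2)) ≤
      ENNReal.ofReal (4 / 3) := by
  set H : ℝ → ℝ≥0∞ := fun u => ENNReal.ofReal (1 - u ^ 2) with hH
  have hHm : Measurable H := by fun_prop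
  have h1 : ∫⁻ s in Ioi (0 : ℝ), H (p + s) = ∫⁻ u in Ioi p, H u := by
    rw [← lintegral_indicator measurableSet_Ioi, ← lintegral_indicator measurableSet_Ioi,
      ← lintegral_add_left_eq_self ((Ioi p).indicator fun u => H u) p]
    simp [indicator]
  have h2 : ∫⁻ s in Ioi (0 : ℝ), H (p - s) = ∫⁻ u in Iio p, H u := by
    rw [← lintegral_indicator measurableSet_Ioi, ← lintegral_indicator measurableSet_Iio,
      ← lintegral_sub_left_eq_self ((Iio p).indicator fun u => H u) p]
    simp [indicator]
  have h3 : ∫⁻ u, H u = ENNReal.ofReal (4 / 3) := by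
    have : ∫⁻ u, H u = ∫⁻ u in Ioc (-1) 1, H u := by
      refine (setLIntegral_eq_of_support_subset ?_).symm
      intro u hu
      have hu : u ^ 2 < 1 := by simpa [H] using hu
      have := abs_lt.1 ((sq_lt_one_iff_abs_lt_one u).1 hu)
      exact ⟨this.1, this.2.le⟩
    rw [this, hH, ← ofReal_integral_eq_lintegral_ofReal,
      ← intervalIntegral.integral_of_le (by norm_num)]
    · rw [intervalIntegral.integral_sub (by simp) (by simp)]
      norm_num
    · exact (Continuous.intervalIntegrable (by fun_prop) _ _).1
    · filter_upwards [ae_restrict_mem measurableSet_Ioc] with u hu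
      simp only [Pi.zero_apply]
      nlinarith [hu.1, hu.2]
  calc
    _ = (∫⁻ u in Ioi p, H u) + ∫⁻ u in Iio p, H u := by
      rw [lintegral_add_left (by fun_prop), ← h1, ← h2]
    _ = ∫⁻ u in Ioi p ∪ Iio p, H u := by
      refine (lintegral_union measurableSet_Iio ?_).symm
      exact disjoint_left.2 fun a ha hb => lt_asymm (mem_Ioi.1 ha) (mem_Iio.1 hb)
    _ ≤ ∫⁻ u, H u := setLIntegral_le_lintegral _ _
    _ = _ := h3

/-- A bound for the Riesz potential of order one of `1 - ‖y‖ ^ 2` on the unit ball. -/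
theorem two_mul_lintegral_inv_norm_pow_mul_le [Nontrivial E] {x : E} (hx : ‖x‖ ≤ 1) :
    2 * ∫⁻ z : E, ENNReal.ofReal ((‖z‖ ^ (finrank ℝ E - 1))⁻¹) *
        ENNReal.ofReal (1 - ‖x + z‖ ^ 2) ≤
      ENNReal.ofReal (4 / 3 * (1 - ‖x‖ ^ 2 + ‖x‖ ^ 2 / finrank ℝ E)) *
        (volume : Measure E).toSphere univ := by
  have hneg : ∫⁻ z : E, ENNReal.ofReal ((‖z‖ ^ (finrank ℝ E - 1))⁻¹) *
        ENNReal.ofReal (1 - ‖x + z‖ ^ 2) = ∫⁻ z : E, ENNReal.ofReal ((‖z‖ ^ (finrank ℝ E - 1))⁻¹) *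
        ENNReal.ofReal (1 - ‖x - z‖ ^ 2) := by
    rw [← lintegral_neg_eq_self]
    simp [sub_eq_add_neg]
  have hN : (finrank ℝ E : ℝ≥0∞) ≠ 0 := by simpa using Module.finrank_pos.ne'
  have hx2 : ‖x‖ ^ 2 ≤ 1 := pow_le_one₀ (norm_nonneg _) hx
  set σ := (volume : Measure E).toSphere
  have hm : ∫⁻ η : sphere (0 : E) 1, ENNReal.ofReal (⟪x, (η : E)⟫ ^ 2) ∂σ =
      ENNReal.ofReal (‖x‖ ^ 2 / finrank ℝ E) * σ univ := by
    have := finrank_mul_lintegral_toSphere_inner_sq x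
    rw [ENNReal.ofReal_div_of_pos (by exact_mod_cast Module.finrank_pos), ENNReal.ofReal_natCast,
      ENNReal.mul_div_right_comm.symm, ← this, mul_comm, ENNReal.mul_div_cancel_right hN (by simp)]
  calc
    _ = ∫⁻ z : E, ENNReal.ofReal ((‖z‖ ^ (finrank ℝ E - 1))⁻¹) *
        (ENNReal.ofReal (1 - ‖x + z‖ ^ 2) + ENNReal.ofReal (1 - ‖x - z‖ ^ 2)) := by
      simp_rw [mul_add]
      rw [lintegral_add_left (by fun_prop), ← hneg, two_mul]
    _ = ∫⁻ η : sphere (0 : E) 1, (∫⁻ s in Ioi (0 : ℝ),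
        (ENNReal.ofReal (1 - ‖x + s • (η : E)‖ ^ 2) +
          ENNReal.ofReal (1 - ‖x - s • (η : E)‖ ^ 2))) ∂σ := by
      rw [lintegral_eq_lintegral_toSphere _ (by fun_prop)]
      refine lintegral_congr fun η => setLIntegral_congr_fun measurableSet_Ioi fun s hs => ?_
      have hs : (0 : ℝ) < s := hs
      have hη : ‖(η : E)‖ = 1 := by simp
      rw [← mul_assoc, ← ENNReal.ofReal_mul (by positivity), norm_smul, hη, mul_one,
        Real.norm_of_nonneg hs.le, mul_inv_cancel₀ (by positivity), ENNReal.ofReal_one, one_mul]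
    _ ≤ ∫⁻ η : sphere (0 : E) 1, ENNReal.ofReal (4 / 3) * (ENNReal.ofReal (1 - ‖x‖ ^ 2) +
        ENNReal.ofReal (⟪x, (η : E)⟫ ^ 2)) ∂σ := by
      refine lintegral_mono fun η => ?_
      have hη : ‖(η : E)‖ = 1 := by simp
      set p := ⟪x, (η : E)⟫ with hp
      have hp2 : p ^ 2 ≤ ‖x‖ ^ 2 := by
        rw [sq_le_sq, abs_norm]
        simpa [hη] using abs_real_inner_le_norm x (η : E)
      have hadd (s : ℝ) : 1 - ‖x + s • (η : E)‖ ^ 2 ≤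
          (1 - ‖x‖ ^ 2 + p ^ 2) * (1 - (p + s) ^ 2) := by
        rw [norm_add_sq_real, inner_smul_right, norm_smul, hη, ← hp, mul_one, Real.norm_eq_abs,
          sq_abs]
        nlinarith [mul_nonneg (sub_nonneg.2 hp2) (sq_nonneg (p + s))]
      have hsub (s : ℝ) : 1 - ‖x - s • (η : E)‖ ^ 2 ≤
          (1 - ‖x‖ ^ 2 + p ^ 2) * (1 - (p - s) ^ 2) := by
        simpa [sub_eq_add_neg] using hadd (-s)
      have hq : 0 ≤ 1 - ‖x‖ ^ 2 + p ^ 2 := by nlinarith [sq_nonneg p]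
      rw [← ENNReal.ofReal_add (by linarith) (sq_nonneg p), mul_comm]
      calc
        _ ≤ ∫⁻ s in Ioi (0 : ℝ), ENNReal.ofReal (1 - ‖x‖ ^ 2 + p ^ 2) *
            (ENNReal.ofReal (1 - (p + s) ^ 2) + ENNReal.ofReal (1 - (p - s) ^ 2)) := by
          refine lintegral_mono fun s => ?_
          rw [mul_add, ← ENNReal.ofReal_mul hq, ← ENNReal.ofReal_mul hq]
          exact add_le_add (ENNReal.ofReal_le_ofReal (hadd s)) (ENNReal.ofReal_le_ofReal (hsub s))
        _ ≤ _ := by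
          rw [lintegral_const_mul _ (by fun_prop)]
          gcongr
          exact lintegral_Ioi_one_sub_sq_le p
    _ = _ := by
      rw [lintegral_const_mul _ (by fun_prop), lintegral_add_left (by fun_prop), hm,
        lintegral_const, ← add_mul, ← mul_assoc, ← ENNReal.ofReal_add (by linarith) (by positivity),
        ← ENNReal.ofReal_mul (by norm_num)]

end Polar

theorem omegaS_eq_toSphere_univ {n : ℕ} (hn : n ≠ 0) :
    (volume : Measure (EuclideanSpace ℝ (Fin n))).toSphere Set.univ =
      ENNReal.ofReal (omegaS n) := by
  have : Nonempty (Fin n) := ⟨⟨0, Nat.pos_of_ne_zero hn⟩⟩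
  have hn' : (0 : ℝ) < n := by exact_mod_cast Nat.pos_of_ne_zero hn
  rw [Measure.toSphere_apply_univ, EuclideanSpace.volume_ball]
  simp only [finrank_euclideanSpace, Fintype.card_fin, ENNReal.ofReal_one, one_pow, one_mul]
  rw [← ENNReal.ofReal_natCast, ← ENNReal.ofReal_mul hn'.le, omegaS,
    Real.Gamma_add_one (by positivity), Real.sqrt_eq_rpow, ← Real.rpow_mul_natCast pi_pos.le]
  congr 1
  have := (Real.Gamma_pos_of_pos (show (0 : ℝ) < n / 2 by positivity)).ne'
  field_simp

theorem norm_sub_le_br {n : ℕ} {x y : EuclideanSpace ℝ (Fin n)} (hx0 : x ≠ 0) (hx : ‖x‖ ≤ 1)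
    (hy : ‖y‖ ≤ 1) : ‖x - y‖ ≤ br x y := by
  have hρ : ‖x‖ ≠ 0 := norm_ne_zero_iff.2 hx0
  refine le_of_sq_le_sq ?_ (norm_nonneg _)
  have hb : br x y ^ 2 = ‖x‖ ^ 2 * ‖y‖ ^ 2 - 2 * inner ℝ x y + 1 := by
    rw [br, norm_sub_sq_real, inner_smul_left, inner_smul_right, norm_smul, norm_smul,
      real_inner_comm]
    simp
    field_simp
  rw [hb, norm_sub_sq_real]
  nlinarith [mul_nonneg (sub_nonneg.2 (pow_le_one₀ (n := 2) (norm_nonneg x) hx))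
    (sub_nonneg.2 (pow_le_one₀ (n := 2) (norm_nonneg y) hy))]

theorem one_sub_norm_mul_norm_le_br {n : ℕ} {x y : EuclideanSpace ℝ (Fin n)} (hx0 : x ≠ 0) :
    1 - ‖x‖ * ‖y‖ ≤ br x y := by
  have hρ : ‖x‖ ≠ 0 := norm_ne_zero_iff.2 hx0
  have := norm_sub_norm_le (‖x‖⁻¹ • x) (‖x‖ • y)
  rw [norm_sub_rev] at this
  simpa [br, norm_smul, hρ] using this

theorem omegaS_pos {n : ℕ} (hn : n ≠ 0) : 0 < omegaS n := by
  have hn' : (0 : ℝ) < n := by exact_mod_cast Nat.pos_of_ne_zero hn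
  have := Real.Gamma_pos_of_pos (show (0 : ℝ) < n / 2 by positivity)
  unfold omegaS
  positivity

theorem norm_gradGreen_le {n : ℕ} (hn : n ≠ 0) {x y : EuclideanSpace ℝ (Fin n)} (hxy : y ≠ x)
    (hx : ‖x‖ ≤ 1) (hy : ‖y‖ ≤ 1) {K : ℝ} (hK0 : 0 ≤ K)
    (hK : 1 - ‖y‖ ^ 2 ≤ K * (1 - ‖x‖ * ‖y‖)) :
    ‖gradGreen x y‖ ≤ (1 + ‖x‖ * K) / omegaS n * (‖y - x‖ ^ (n - 1))⁻¹ := by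
  have hω := omegaS_pos hn
  obtain ⟨m, rfl⟩ := Nat.exists_eq_succ_of_ne_zero hn
  have ha : 0 < ‖x - y‖ := norm_pos_iff.2 (sub_ne_zero.2 hxy.symm)
  rw [gradGreen, norm_smul, norm_sub_rev y x, norm_neg, Real.norm_of_nonneg (by positivity),
    div_mul_eq_mul_div, one_mul, div_mul_eq_mul_div]
  gcongr
  set a := ‖x - y‖ with ha'
  have hrem : ‖(a ^ (m + 1))⁻¹ • (x - y)‖ = (a ^ m)⁻¹ := by
    rw [norm_smul, ← ha', Real.norm_of_nonneg (by positivity)]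
    field_simp
    ring
  simp only [Nat.succ_eq_add_one, Nat.add_sub_cancel]
  by_cases hx0 : x = 0
  · have : br x y = 0 := by simp [br, hx0]
    rw [this]
    rw [zero_pow m.succ_ne_zero, inv_zero, zero_smul, sub_zero, hrem]
    simp [hx0]
  · have hab : a ≤ br x y := norm_sub_le_br hx0 hx hy
    have hrb := one_sub_norm_mul_norm_le_br (y := y) hx0
    set b := br x y
    have hb : 0 < b := ha.trans_le hab
    have hinv : (b ^ (m + 1))⁻¹ ≤ (a ^ (m + 1))⁻¹ := by gcongr
    have hy2 : 0 ≤ 1 - ‖y‖ ^ 2 := sub_nonneg.2 (pow_le_one₀ (norm_nonneg y) hy)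
    have heq : (a ^ (m + 1))⁻¹ • (x - y) - (b ^ (m + 1))⁻¹ • (‖y‖ ^ 2 • x - y) =
        ((a ^ (m + 1))⁻¹ - (b ^ (m + 1))⁻¹) • (x - y) +
          ((b ^ (m + 1))⁻¹ * (1 - ‖y‖ ^ 2)) • x := by
      module
    rw [heq]
    have hbm : (b ^ m)⁻¹ ≤ (a ^ m)⁻¹ := by gcongr
    calc
      _ ≤ ((a ^ (m + 1))⁻¹ - (b ^ (m + 1))⁻¹) * a + (b ^ (m + 1))⁻¹ * (1 - ‖y‖ ^ 2) * ‖x‖ := by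
        refine (norm_add_le _ _).trans_eq ?_
        rw [norm_smul, norm_smul, Real.norm_of_nonneg (sub_nonneg.2 hinv),
          Real.norm_of_nonneg (by positivity)]
      _ ≤ (a ^ (m + 1))⁻¹ * a + (b ^ (m + 1))⁻¹ * (K * b) * ‖x‖ := by
        gcongr
        · exact sub_le_self _ (by positivity)
        · exact hK.trans (by gcongr)
      _ = (a ^ m)⁻¹ + ‖x‖ * K * (b ^ m)⁻¹ := by
        field_simp
        ring
      _ ≤ _ := by
        rw [add_mul, one_mul]
        gcongr

theorem le_cZero : 21 / 8 ≤ cZero := by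
  refine le_csSup ⟨4, ?_⟩ ⟨1 / 2, by norm_num, by norm_num⟩
  rintro _ ⟨t, ⟨h0, h1⟩, rfl⟩
  simp only
  nlinarith [mul_nonneg h0 (sub_nonneg.2 h1.le), sq_nonneg t]

theorem le_deltaN {n : ℕ} (hn : 3 ≤ n) : 7 / 8 ≤ deltaN n := by
  have hn' : (3 : ℝ) ≤ n := by exact_mod_cast hn
  have h1 : (0 : ℝ) < (n : ℝ) ^ 2 - 1 := by nlinarith
  have h2 : (0 : ℝ) ≤ (n : ℝ) ^ 2 - 4 := by nlinarith
  calc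
    (7 / 8 : ℝ) ≤ (((n : ℝ) ^ 2 - 4) / (3 * ((n : ℝ) ^ 2 - 1))) * (21 / 8) +
        4 / ((n : ℝ) * (n + 1)) := by
      rw [← sub_nonneg]
      have : (((n : ℝ) ^ 2 - 4) / (3 * ((n : ℝ) ^ 2 - 1))) * (21 / 8) +
          4 / ((n : ℝ) * (n + 1)) - 7 / 8 = (11 * n - 32) / (8 * n * ((n : ℝ) ^ 2 - 1)) := by
        have : (n : ℝ) - 1 ≠ 0 := by linarith
        have h3 : (n : ℝ) ^ 2 - 1 = (n - 1) * (n + 1) := by ring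
        rw [h3]
        field_simp
        ring
      rw [this]
      exact div_nonneg (by linarith) (by positivity)
    _ ≤ _ := by
      unfold deltaN
      gcongr
      exact le_cZero

theorem exists_one_sub_sq_le {ρ : ℝ} (h0 : 0 ≤ ρ) (h1 : ρ ≤ 1) : ∃ K : ℝ, 0 ≤ K ∧
    (∀ r, 0 ≤ r → r ≤ 1 → 1 - r ^ 2 ≤ K * (1 - ρ * r)) ∧
      2 / 3 * (1 - 2 / 3 * ρ ^ 2) * (1 + ρ * K) ≤ 7 / 8 := by
  rcases le_total ρ (9 / 10) with h | h
  · refine ⟨1 + ρ ^ 2 / 2, by positivity, fun r hr0 hr1 => ?_, ?_⟩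
    · have hρ : ρ ^ 2 ≤ 81 / 100 := by nlinarith
      have : 0 ≤ 2 - (1 + ρ ^ 2 / 2) ^ 2 := by nlinarith [sq_nonneg ρ]
      nlinarith [sq_nonneg (2 * r - (1 + ρ ^ 2 / 2) * ρ), mul_nonneg (sq_nonneg ρ) this]
    · nlinarith [mul_nonneg h0 (sq_nonneg (ρ - 11 / 20)),
        mul_nonneg h0 (sq_nonneg (ρ ^ 2 - (11 / 20) ^ 2)), sq_nonneg (ρ - 11 / 20),
        sq_nonneg (ρ ^ 2 - (11 / 20) ^ 2)]
  · refine ⟨2, by norm_num, fun r hr0 hr1 => ?_, ?_⟩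
    · nlinarith
    · nlinarith

theorem stmt7 (n : ℕ) (hn : 3 ≤ n) (x : EuclideanSpace ℝ (Fin n))
    (hx : x ∈ Metric.ball (0 : EuclideanSpace ℝ (Fin n)) 1) :
    (∫ y in Metric.ball (0 : EuclideanSpace ℝ (Fin n)) 1, ‖gradGreen x y‖ * (1 - ‖y‖ ^ 2))
      ≤ deltaN n := by
  have hn0 : n ≠ 0 := by omega
  have : Nonempty (Fin n) := ⟨⟨0, Nat.pos_of_ne_zero hn0⟩⟩
  have hx1 : ‖x‖ ≤ 1 := (mem_ball_zero_iff.1 hx).le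
  have hω := omegaS_pos hn0
  obtain ⟨K, hK0, hK, hKle⟩ := exists_one_sub_sq_le (norm_nonneg x) hx1
  refine le_trans ?_ (le_deltaN hn)
  refine (Real.le_norm_self _).trans ((norm_integral_le_lintegral_norm _).trans ?_)
  refine ENNReal.toReal_le_of_le_ofReal (by norm_num) ?_
  set C := (1 + ‖x‖ * K) / omegaS n with hC
  have hC0 : 0 ≤ C := by positivity
  have hmoment := two_mul_lintegral_inv_norm_pow_mul_le hx1
  rw [omegaS_eq_toSphere_univ hn0, ← ENNReal.ofReal_mul' hω.le, finrank_euclideanSpace,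
    Fintype.card_fin] at hmoment
  set J := ∫⁻ z : EuclideanSpace ℝ (Fin n), ENNReal.ofReal ((‖z‖ ^ (n - 1))⁻¹) *
        ENNReal.ofReal (1 - ‖x + z‖ ^ 2) with hJ
  have hn' : (3 : ℝ) ≤ n := by exact_mod_cast hn
  calc
    _ ≤ ∫⁻ y in ball (0 : EuclideanSpace ℝ (Fin n)) 1, ENNReal.ofReal C *
        (ENNReal.ofReal ((‖y - x‖ ^ (n - 1))⁻¹) * ENNReal.ofReal (1 - ‖y‖ ^ 2)) := by
      refine lintegral_mono_ae ?_
      filter_upwards [ae_restrict_mem measurableSet_ball,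
        ae_restrict_of_ae (Measure.ae_ne volume x)] with y hy hyx
      have hy1 : ‖y‖ ≤ 1 := (mem_ball_zero_iff.1 hy).le
      have hy2 : 0 ≤ 1 - ‖y‖ ^ 2 := sub_nonneg.2 (pow_le_one₀ (norm_nonneg y) hy1)
      rw [← ENNReal.ofReal_mul (by positivity), ← ENNReal.ofReal_mul hC0, ← mul_assoc,
        Real.norm_of_nonneg (by positivity)]
      gcongr
      exact norm_gradGreen_le hn0 hyx hx1 hy1 hK0 (hK _ (norm_nonneg y) hy1)
    _ ≤ ∫⁻ y : EuclideanSpace ℝ (Fin n), ENNReal.ofReal C *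
        (ENNReal.ofReal ((‖y - x‖ ^ (n - 1))⁻¹) * ENNReal.ofReal (1 - ‖y‖ ^ 2)) :=
      setLIntegral_le_lintegral _ _
    _ = ENNReal.ofReal C * J := by
      rw [lintegral_const_mul _ (by fun_prop), ← lintegral_add_left_eq_self _ x]
      simp [hJ]
    _ = ENNReal.ofReal (C / 2) * (2 * J) := by
      rw [← mul_assoc, ← ENNReal.ofReal_ofNat 2, ← ENNReal.ofReal_mul (by positivity)]
      congr 2
      norm_num
    _ ≤ _ := by
      refine (mul_le_mul_right hmoment _).trans ?_
      rw [← ENNReal.ofReal_mul (by positivity)]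
      refine ENNReal.ofReal_le_ofReal (le_trans ?_ hKle)
      have h3 : ‖x‖ ^ 2 / n ≤ ‖x‖ ^ 2 / 3 := by gcongr
      have : C / 2 * (4 / 3 * (1 - ‖x‖ ^ 2 + ‖x‖ ^ 2 / n) * omegaS n) =
          2 / 3 * (1 - ‖x‖ ^ 2 + ‖x‖ ^ 2 / n) * (1 + ‖x‖ * K) := by
        rw [hC]
        field_simp
        ring
      rw [this]
      gcongr
      linarith
end
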